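/- Generalized propagation theorem: let N be a society, ∇ an ES basic fusion operator satisfying (ESF-SD), (ESF-P) and (ESF-I), and D an N-coalition. If there exist distinct valuations w, w′ and epistemic states E_{w,w′}, E_{w′} with [B(E_{w,w′})] = {w,w′} and [B(E_{w′})] = {w′} such that D is locally decisive for E_{w,w′} against E_{w′}, then D is a decisive N-coalition. -/

import Mathlib

/- Common framework for logic-based merging of epistemic states
   (Mata Díaz & Pino Pérez, "Impossibility in Belief Merging"). -/

namespace BeliefMerging

/-- A profile: a nonempty finite society of agents together with an
assignment of an epistemic state to each agent of the society. -/
structure Profile (S ℰ : Type) where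
  soc : Finset S
  soc_nonempty : soc.Nonempty
  val : {x // x ∈ soc} → ℰ

variable {S ℰ W : Type}

/-- The singleton profile of agent `i` with epistemic state `E`. -/
def Profile.single (i : S) (E : ℰ) : Profile S ℰ :=
  ⟨{i}, Finset.singleton_nonempty i, fun _ => E⟩

/-- Restriction of a profile to a nonempty subsociety. -/
def Profile.restrict (Φ : Profile S ℰ) (M : Finset S) (hM : M.Nonempty)
    (hsub : M ⊆ Φ.soc) : Profile S ℰ :=
  ⟨M, hM, fun i => Φ.val ⟨i.1, hsub i.2⟩⟩

/-- Equivalence of profiles: societies of the same cardinality whose states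
correspond under the unique order-preserving bijection. -/
def Profile.Equiv [LinearOrder S] (Φ Ψ : Profile S ℰ) : Prop :=
  ∃ h : Φ.soc.card = Ψ.soc.card,
    ∀ k : Fin Φ.soc.card,
      Φ.val (Φ.soc.orderIsoOfFin rfl k) = Ψ.val (Ψ.soc.orderIsoOfFin h.symm k)

/-- (ESF1) -/
def ESF1 (B : ℰ → Set W) (nab : Profile S ℰ → ℰ → ℰ) : Prop :=
  ∀ (Φ : Profile S ℰ) (E : ℰ), B (nab Φ E) ⊆ B E

/-- (ESF2) -/
def ESF2 [LinearOrder S] (B : ℰ → Set W) (nab : Profile S ℰ → ℰ → ℰ) : Prop :=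
  ∀ (Φ Φ' : Profile S ℰ) (E E' : ℰ), Profile.Equiv Φ Φ' → B E = B E' →
    B (nab Φ E) = B (nab Φ' E')

/-- (ESF3) -/
def ESF3 (B : ℰ → Set W) (nab : Profile S ℰ → ℰ → ℰ) : Prop :=
  ∀ (Φ : Profile S ℰ) (E E' E'' : ℰ), B E = B E' ∩ B E'' →
    B (nab Φ E') ∩ B E'' ⊆ B (nab Φ E)

/-- (ESF4) -/
def ESF4 (B : ℰ → Set W) (nab : Profile S ℰ → ℰ → ℰ) : Prop :=
  ∀ (Φ : Profile S ℰ) (E E' E'' : ℰ), B E = B E' ∩ B E'' →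
    (B (nab Φ E') ∩ B E'').Nonempty →
    B (nab Φ E) ⊆ B (nab Φ E') ∩ B E''

/-- ES basic fusion operator: (ESF1)–(ESF4). -/
def BasicFusion [LinearOrder S] (B : ℰ → Set W) (nab : Profile S ℰ → ℰ → ℰ) : Prop :=
  ESF1 B nab ∧ ESF2 B nab ∧ ESF3 B nab ∧ ESF4 B nab

/-- (ESF5) -/
def ESF5 (B : ℰ → Set W) (nab : Profile S ℰ → ℰ → ℰ) : Prop :=
  ∀ (j k : S) (Ej Ek : ℰ), Ej ≠ Ek →
    ∃ E' : ℰ, B (nab (Profile.single j Ej) E') ≠ B (nab (Profile.single k Ek) E')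

/-- (ESF6) -/
def ESF6 (B : ℰ → Set W) (nab : Profile S ℰ → ℰ → ℰ) : Prop :=
  ∀ (Φ : Profile S ℰ) (E : ℰ),
    ((⋂ i : {x // x ∈ Φ.soc}, B (Φ.val i)) ∩ B E).Nonempty →
    B (nab Φ E) = (⋂ i : {x // x ∈ Φ.soc}, B (Φ.val i)) ∩ B E

/-- (ESF7) -/
def ESF7 [DecidableEq S] (B : ℰ → Set W) (nab : Profile S ℰ → ℰ → ℰ) : Prop :=
  ∀ (Φ : Profile S ℰ) (N₁ N₂ : Finset S) (h₁ : N₁.Nonempty) (h₂ : N₂.Nonempty)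
    (hs₁ : N₁ ⊆ Φ.soc) (hs₂ : N₂ ⊆ Φ.soc),
    Disjoint N₁ N₂ → N₁ ∪ N₂ = Φ.soc → ∀ E : ℰ,
      B (nab (Φ.restrict N₁ h₁ hs₁) E) ∩ B (nab (Φ.restrict N₂ h₂ hs₂) E) ⊆
        B (nab Φ E)

/-- (ESF8) -/
def ESF8 [DecidableEq S] (B : ℰ → Set W) (nab : Profile S ℰ → ℰ → ℰ) : Prop :=
  ∀ (Φ : Profile S ℰ) (N₁ N₂ : Finset S) (h₁ : N₁.Nonempty) (h₂ : N₂.Nonempty)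
    (hs₁ : N₁ ⊆ Φ.soc) (hs₂ : N₂ ⊆ Φ.soc),
    Disjoint N₁ N₂ → N₁ ∪ N₂ = Φ.soc → ∀ E : ℰ,
      (B (nab (Φ.restrict N₁ h₁ hs₁) E) ∩ B (nab (Φ.restrict N₂ h₂ hs₂) E)).Nonempty →
      B (nab Φ E) ⊆
        B (nab (Φ.restrict N₁ h₁ hs₁) E) ∩ B (nab (Φ.restrict N₂ h₂ hs₂) E)

/-- (ESF8W) -/
def ESF8W [DecidableEq S] (B : ℰ → Set W) (nab : Profile S ℰ → ℰ → ℰ) : Prop :=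
  ∀ (Φ : Profile S ℰ) (N₁ N₂ : Finset S) (h₁ : N₁.Nonempty) (h₂ : N₂.Nonempty)
    (hs₁ : N₁ ⊆ Φ.soc) (hs₂ : N₂ ⊆ Φ.soc),
    Disjoint N₁ N₂ → N₁ ∪ N₂ = Φ.soc → ∀ E : ℰ,
      (B (nab (Φ.restrict N₁ h₁ hs₁) E) ∩ B (nab (Φ.restrict N₂ h₂ hs₂) E)).Nonempty →
      B (nab Φ E) ⊆
        B (nab (Φ.restrict N₁ h₁ hs₁) E) ∪ B (nab (Φ.restrict N₂ h₂ hs₂) E)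

/-- ES fusion operator: (ESF1)–(ESF8). -/
def Fusion [LinearOrder S] (B : ℰ → Set W) (nab : Profile S ℰ → ℰ → ℰ) : Prop :=
  BasicFusion B nab ∧ ESF5 B nab ∧ ESF6 B nab ∧ ESF7 B nab ∧ ESF8 B nab

/-- ES quasifusion operator: (ESF1)–(ESF7) and (ESF8W). -/
def Quasifusion [LinearOrder S] (B : ℰ → Set W) (nab : Profile S ℰ → ℰ → ℰ) : Prop :=
  BasicFusion B nab ∧ ESF5 B nab ∧ ESF6 B nab ∧ ESF7 B nab ∧ ESF8W B nab

/-- (ESF-SD), Standard Domain. -/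
def ESFSD (B : ℰ → Set W) (nab : Profile S ℰ → ℰ → ℰ) : Prop :=
  ∀ (i : S) (w w' w'' : W), w ≠ w' → w ≠ w'' → w' ≠ w'' →
  ∀ (E₁ E₂ : ℰ), B E₁ = {w, w'} → B E₂ = {w', w''} →
    (∃ Ei : ℰ, B (nab (Profile.single i Ei) E₁) = {w, w'} ∧
               B (nab (Profile.single i Ei) E₂) = {w', w''}) ∧
    (∃ Ei : ℰ, B (nab (Profile.single i Ei) E₁) = {w, w'} ∧
               B (nab (Profile.single i Ei) E₂) = {w'}) ∧
    (∃ Ei : ℰ, B (nab (Profile.single i Ei) E₁) = {w} ∧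
               B (nab (Profile.single i Ei) E₂) = {w', w''}) ∧
    (∃ Ei : ℰ, B (nab (Profile.single i Ei) E₁) = {w} ∧
               B (nab (Profile.single i Ei) E₂) = {w'})

/-- (ESF-U), Unanimity. -/
def ESFU (B : ℰ → Set W) (nab : Profile S ℰ → ℰ → ℰ) : Prop :=
  ∀ (Φ : Profile S ℰ), (∀ i j : {x // x ∈ Φ.soc}, Φ.val i = Φ.val j) →
    ∀ (E : ℰ) (i : {x // x ∈ Φ.soc}),
      B (nab Φ E) = B (nab (Profile.single i.1 (Φ.val i)) E)

/-- (ESF-P), Pareto. -/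
def ESFP (B : ℰ → Set W) (nab : Profile S ℰ → ℰ → ℰ) : Prop :=
  ∀ (Φ : Profile S ℰ) (E E' : ℰ),
    (⋂ i : {x // x ∈ Φ.soc}, B (nab (Profile.single i.1 (Φ.val i)) E)).Nonempty →
    (∀ i : {x // x ∈ Φ.soc}, B (nab (Profile.single i.1 (Φ.val i)) E) ∩ B E' = ∅) →
    B (nab Φ E) ∩ B E' = ∅

/-- (ESF-I), Independence. -/
def ESFI (B : ℰ → Set W) (nab : Profile S ℰ → ℰ → ℰ) : Prop :=
  ∀ (N : Finset S) (hN : N.Nonempty) (f g : {x // x ∈ N} → ℰ) (E : ℰ),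
    (∀ E' : ℰ, B E' ⊆ B E → ∀ j : {x // x ∈ N},
      B (nab (Profile.single j.1 (f j)) E') = B (nab (Profile.single j.1 (g j)) E')) →
    B (nab ⟨N, hN, f⟩ E) = B (nab ⟨N, hN, g⟩ E)

/-- (ESF-D), Dictator. -/
def ESFD (B : ℰ → Set W) (nab : Profile S ℰ → ℰ → ℰ) : Prop :=
  ∀ (N : Finset S) (hN : N.Nonempty), ∃ d : {x // x ∈ N},
    ∀ (f : {x // x ∈ N} → ℰ) (E : ℰ),
      B (nab ⟨N, hN, f⟩ E) ⊆ B (nab (Profile.single d.1 (f d)) E)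

/-- The maximal elements of `C` with respect to the total preorder `R`. -/
def MaxSet (C : Set W) (R : W → W → Prop) : Set W :=
  {w ∈ C | ∀ w' ∈ C, R w w'}

/-- The strict part of a total preorder. -/
def StrictRel (R : W → W → Prop) (a b : W) : Prop := R a b ∧ ¬ R b a

/-- An assignment: each profile is mapped to a total preorder over valuations. -/
def IsAssignment (f : Profile S ℰ → W → W → Prop) : Prop :=
  ∀ Φ : Profile S ℰ, (∀ a b : W, f Φ a b ∨ f Φ b a) ∧
    (∀ a b c : W, f Φ a b → f Φ b c → f Φ a c)

/-- A basic assignment: an assignment sending equivalent profiles to equal preorders. -/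
def IsBasicAssignment [LinearOrder S] (f : Profile S ℰ → W → W → Prop) : Prop :=
  IsAssignment f ∧ ∀ Φ Ψ : Profile S ℰ, Profile.Equiv Φ Ψ → f Φ = f Ψ

/-- The assignment `f` represents the operator `nab`. -/
def Represents (B : ℰ → Set W) (nab : Profile S ℰ → ℰ → ℰ)
    (f : Profile S ℰ → W → W → Prop) : Prop :=
  ∀ (Φ : Profile S ℰ) (E : ℰ), B (nab Φ E) = MaxSet (B E) (f Φ)

/-- Property 1. -/
def Prop1 (f : Profile S ℰ → W → W → Prop) : Prop :=
  ∀ (j k : S) (Ej Ek : ℰ), Ej ≠ Ek →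
    f (Profile.single j Ej) ≠ f (Profile.single k Ek)

/-- Property 2. -/
def Prop2 (B : ℰ → Set W) (f : Profile S ℰ → W → W → Prop) : Prop :=
  ∀ Φ : Profile S ℰ, (⋂ i : {x // x ∈ Φ.soc}, B (Φ.val i)).Nonempty →
    (⋂ i : {x // x ∈ Φ.soc}, B (Φ.val i)) = MaxSet Set.univ (f Φ)

/-- Property 3. -/
def Prop3 [DecidableEq S] (f : Profile S ℰ → W → W → Prop) : Prop :=
  ∀ (Φ : Profile S ℰ) (N₁ N₂ : Finset S) (h₁ : N₁.Nonempty) (h₂ : N₂.Nonempty)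
    (hs₁ : N₁ ⊆ Φ.soc) (hs₂ : N₂ ⊆ Φ.soc),
    Disjoint N₁ N₂ → N₁ ∪ N₂ = Φ.soc → ∀ w w' : W,
      f (Φ.restrict N₁ h₁ hs₁) w w' → f (Φ.restrict N₂ h₂ hs₂) w w' → f Φ w w'

/-- Property 4. -/
def Prop4 [DecidableEq S] (f : Profile S ℰ → W → W → Prop) : Prop :=
  ∀ (Φ : Profile S ℰ) (N₁ N₂ : Finset S) (h₁ : N₁.Nonempty) (h₂ : N₂.Nonempty)
    (hs₁ : N₁ ⊆ Φ.soc) (hs₂ : N₂ ⊆ Φ.soc),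
    Disjoint N₁ N₂ → N₁ ∪ N₂ = Φ.soc → ∀ w w' : W,
      f (Φ.restrict N₁ h₁ hs₁) w w' → StrictRel (f (Φ.restrict N₂ h₂ hs₂)) w w' →
        StrictRel (f Φ) w w'

/-- Property 4′. -/
def Prop4' [DecidableEq S] (f : Profile S ℰ → W → W → Prop) : Prop :=
  ∀ (Φ : Profile S ℰ) (N₁ N₂ : Finset S) (h₁ : N₁.Nonempty) (h₂ : N₂.Nonempty)
    (hs₁ : N₁ ⊆ Φ.soc) (hs₂ : N₂ ⊆ Φ.soc),
    Disjoint N₁ N₂ → N₁ ∪ N₂ = Φ.soc → ∀ w w' : W,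
      StrictRel (f (Φ.restrict N₁ h₁ hs₁)) w w' →
      StrictRel (f (Φ.restrict N₂ h₂ hs₂)) w w' →
        StrictRel (f Φ) w w'

/-- The Maximality Condition. -/
def Maximality (B : ℰ → Set W) (f : Profile S ℰ → W → W → Prop) : Prop :=
  ∀ (i : S) (E : ℰ), B E = MaxSet Set.univ (f (Profile.single i E))

/-- Faithful assignment: basic + Properties 1–4. -/
def IsFaithfulAssignment [LinearOrder S] (B : ℰ → Set W)
    (f : Profile S ℰ → W → W → Prop) : Prop :=
  IsBasicAssignment f ∧ Prop1 f ∧ Prop2 B f ∧ Prop3 f ∧ Prop4 f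

/-- Quasifaithful assignment: basic + Properties 1–3 and 4′. -/
def IsQuasifaithfulAssignment [LinearOrder S] (B : ℰ → Set W)
    (f : Profile S ℰ → W → W → Prop) : Prop :=
  IsBasicAssignment f ∧ Prop1 f ∧ Prop2 B f ∧ Prop3 f ∧ Prop4' f

/-- Property (u). -/
def PropU (f : Profile S ℰ → W → W → Prop) : Prop :=
  ∀ (Φ : Profile S ℰ), (∀ i j : {x // x ∈ Φ.soc}, Φ.val i = Φ.val j) →
    ∀ i : {x // x ∈ Φ.soc}, f Φ = f (Profile.single i.1 (Φ.val i))

/-- Property (p). -/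
def PropP (f : Profile S ℰ → W → W → Prop) : Prop :=
  ∀ (Φ : Profile S ℰ) (w w' : W),
    (∀ i : {x // x ∈ Φ.soc}, StrictRel (f (Profile.single i.1 (Φ.val i))) w w') →
    StrictRel (f Φ) w w'

/-- Two relations coincide on the pair `{w, w'}`. -/
def SameOnPair (R R' : W → W → Prop) (w w' : W) : Prop :=
  (R w w' ↔ R' w w') ∧ (R w' w ↔ R' w' w)

/-- Property (ind). -/
def PropInd (f : Profile S ℰ → W → W → Prop) : Prop :=
  ∀ (N : Finset S) (hN : N.Nonempty) (g g' : {x // x ∈ N} → ℰ) (w w' : W),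
    (∀ i : {x // x ∈ N},
      SameOnPair (f (Profile.single i.1 (g i))) (f (Profile.single i.1 (g' i))) w w') →
    SameOnPair (f ⟨N, hN, g⟩) (f ⟨N, hN, g'⟩) w w'

/-- Property (d). -/
def PropD (f : Profile S ℰ → W → W → Prop) : Prop :=
  ∀ (N : Finset S) (hN : N.Nonempty), ∃ d : {x // x ∈ N},
    ∀ (g : {x // x ∈ N} → ℰ) (w w' : W),
      StrictRel (f (Profile.single d.1 (g d))) w w' → StrictRel (f ⟨N, hN, g⟩) w w'

/-- `D` is a locally decisive `N`-coalition for `E` against `E'`. -/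
def LocallyDecisiveFor (B : ℰ → Set W) (nab : Profile S ℰ → ℰ → ℰ)
    (N : Finset S) (hN : N.Nonempty) (D : Finset S) (hD : D ⊆ N) (E E' : ℰ) : Prop :=
  ∀ f : {x // x ∈ N} → ℰ,
    (∀ i : {x // x ∈ D}, B (nab (Profile.single i.1 (f ⟨i.1, hD i.2⟩)) E) ∩ B E' = ∅) →
    (∀ j : {x // x ∈ N}, j.1 ∉ D → B (nab (Profile.single j.1 (f j)) E) = B E') →
    (⋂ i : {x // x ∈ D}, B (nab (Profile.single i.1 (f ⟨i.1, hD i.2⟩)) E)).Nonempty →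
    B (nab ⟨N, hN, f⟩ E) ∩ B E' = ∅

/-- `D` is a decisive `N`-coalition for `E` against `E'`. -/
def DecisiveFor (B : ℰ → Set W) (nab : Profile S ℰ → ℰ → ℰ)
    (N : Finset S) (hN : N.Nonempty) (D : Finset S) (hD : D ⊆ N) (E E' : ℰ) : Prop :=
  ∀ f : {x // x ∈ N} → ℰ,
    (∀ i : {x // x ∈ D}, B (nab (Profile.single i.1 (f ⟨i.1, hD i.2⟩)) E) ∩ B E' = ∅) →
    (⋂ i : {x // x ∈ D}, B (nab (Profile.single i.1 (f ⟨i.1, hD i.2⟩)) E)).Nonempty →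
    B (nab ⟨N, hN, f⟩ E) ∩ B E' = ∅

/-- `D` is a decisive `N`-coalition. -/
def DecisiveCoalition (B : ℰ → Set W) (nab : Profile S ℰ → ℰ → ℰ)
    (N : Finset S) (hN : N.Nonempty) (D : Finset S) (hD : D ⊆ N) : Prop :=
  ∀ E E' : ℰ, DecisiveFor B nab N hN D hD E E'

end BeliefMerging

namespace BeliefMerging

section PairwiseRelations

variable {V : Type} {R : V → V → Prop}

theorem mem_maxSet_pair_left {a b : V} (hR : ∀ x y, R x y ∨ R y x) :
    a ∈ MaxSet {a, b} R ↔ R a b := by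
  have haa : R a a := (hR a a).elim id id
  simp [MaxSet, haa]

theorem mem_maxSet_pair_right {a b : V} (hR : ∀ x y, R x y ∨ R y x) :
    b ∈ MaxSet {a, b} R ↔ R b a := by
  rw [Set.pair_comm]
  exact mem_maxSet_pair_left hR

theorem maxSet_pair_eq_left_iff {a b : V} (hR : ∀ x y, R x y ∨ R y x) (hab : a ≠ b) :
    MaxSet {a, b} R = {a} ↔ StrictRel R a b := by
  constructor
  · intro h
    refine ⟨(mem_maxSet_pair_left hR).1 (by simp [h]), fun hba => hab ?_⟩
    have hb : b ∈ MaxSet {a, b} R := (mem_maxSet_pair_right hR).2 hba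
    rw [h] at hb
    exact hb.symm
  · rintro ⟨h, h'⟩
    ext x
    constructor
    · intro hx
      rcases hx.1 with rfl | rfl
      · rfl
      · exact absurd ((mem_maxSet_pair_right hR).1 hx) h'
    · rintro rfl
      exact (mem_maxSet_pair_left hR).2 h

theorem maxSet_pair_eq_self {a b : V} (hR : ∀ x y, R x y ∨ R y x)
    (h : MaxSet {a, b} R = {a, b}) : R a b ∧ R b a :=
  ⟨(mem_maxSet_pair_left hR).1 (by simp [h]), (mem_maxSet_pair_right hR).1 (by simp [h])⟩

theorem StrictRel.transitive {a b c : V} (hR : ∀ x y z, R x y → R y z → R x z)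
    (hab : StrictRel R a b) (hbc : StrictRel R b c) : StrictRel R a c :=
  ⟨hR _ _ _ hab.1 hbc.1, fun hca => hab.2 (hR _ _ _ hbc.1 hca)⟩

theorem SameOnPair.strictRel_iff {R' : V → V → Prop} {a b : V} (h : SameOnPair R R' a b) :
    StrictRel R a b ↔ StrictRel R' a b := by
  rw [StrictRel, StrictRel, h.1, h.2]

theorem SameOnPair.maxSet_eq {R' : V → V → Prop} (hR : ∀ x y, R x y ∨ R y x)
    (hR' : ∀ x y, R' x y ∨ R' y x) {a b : V} (h : SameOnPair R R' a b) {C : Set V}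
    (hC : C ⊆ {a, b}) : MaxSet C R = MaxSet C R' := by
  have haa : R a a := (hR a a).elim id id
  have hbb : R b b := (hR b b).elim id id
  have haa' : R' a a := (hR' a a).elim id id
  have hbb' : R' b b := (hR' b b).elim id id
  have key : ∀ x ∈ C, ∀ y ∈ C, (R x y ↔ R' x y) := by
    intro x hx y hy
    rcases hC hx with rfl | rfl <;> rcases hC hy with rfl | rfl
    · simp only [haa, haa']
    · exact h.1
    · exact h.2
    · simp only [hbb, hbb']
  ext x
  exact and_congr_right fun hx => forall₂_congr fun y hy => key x hx y hy

/-- Three distinct alternatives can be ranked by an admissible relation with the first two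
strictly ranked or tied, and the last two strictly ranked or tied, not both tied. -/
def RichOnTriples {P : Type} (r : P → V → V → Prop) : Prop :=
  ∀ x y z : V, x ≠ y → x ≠ z → y ≠ z →
    (∃ p, StrictRel (r p) x y ∧ StrictRel (r p) y z) ∧
    (∃ p, StrictRel (r p) x y ∧ r p y z ∧ r p z y) ∧
    (∃ p, r p x y ∧ r p y x ∧ StrictRel (r p) y z)

theorem RichOnTriples.exists_top {P : Type} {r : P → V → V → Prop} (hr : RichOnTriples r)
    (htrans : ∀ p x y z, r p x y → r p y z → r p x z)
    (hR : ∀ x y, R x y ∨ R y x) {a b c : V} (hab : a ≠ b) (hac : a ≠ c) (hbc : b ≠ c) :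
    ∃ p, StrictRel (r p) b a ∧ StrictRel (r p) b c ∧ SameOnPair (r p) R a c := by
  by_cases h1 : R a c <;> by_cases h2 : R c a
  · obtain ⟨p, h, h', h''⟩ := (hr b a c hab.symm hbc hac).2.1
    exact ⟨p, h, ⟨htrans _ _ _ _ h.1 h', fun k => h.2 (htrans _ _ _ _ h' k)⟩,
      iff_of_true h' h1, iff_of_true h'' h2⟩
  · obtain ⟨p, h, h'⟩ := (hr b a c hab.symm hbc hac).1
    exact ⟨p, h, h.transitive (htrans p) h', iff_of_true h'.1 h1, iff_of_false h'.2 h2⟩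
  · obtain ⟨p, h, h'⟩ := (hr b c a hbc hab.symm hac.symm).1
    exact ⟨p, h.transitive (htrans p) h', h, iff_of_false h'.2 h1, iff_of_true h'.1 h2⟩
  · exact absurd (hR a c) (by tauto)

theorem RichOnTriples.exists_bottom {P : Type} {r : P → V → V → Prop} (hr : RichOnTriples r)
    (htrans : ∀ p x y z, r p x y → r p y z → r p x z)
    (hR : ∀ x y, R x y ∨ R y x) {a b c : V} (hab : a ≠ b) (hac : a ≠ c) (hbc : b ≠ c) :
    ∃ p, StrictRel (r p) b a ∧ StrictRel (r p) c a ∧ SameOnPair (r p) R c b := by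
  by_cases h1 : R c b <;> by_cases h2 : R b c
  · obtain ⟨p, h, h', h''⟩ := (hr c b a hbc.symm hac.symm hab.symm).2.2
    exact ⟨p, h'', ⟨htrans _ _ _ _ h h''.1, fun k => h''.2 (htrans _ _ _ _ k h)⟩,
      iff_of_true h h1, iff_of_true h' h2⟩
  · obtain ⟨p, h, h'⟩ := (hr c b a hbc.symm hac.symm hab.symm).1
    exact ⟨p, h', h.transitive (htrans p) h', iff_of_true h.1 h1, iff_of_false h.2 h2⟩
  · obtain ⟨p, h, h'⟩ := (hr b c a hbc hab.symm hac.symm).1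
    exact ⟨p, h.transitive (htrans p) h', h', iff_of_false h.2 h1, iff_of_true h.1 h2⟩
  · exact absurd (hR c b) (by tauto)

end PairwiseRelations

section SocialChoice

variable {ι P V : Type} (r : ι → P → V → V → Prop) (F : (ι → P) → V → V → Prop) (D : Set ι)

/-- If the members of `D` strictly prefer `a` to `b`, then so does society. -/
def DecisiveOnPair (a b : V) : Prop :=
  ∀ g : ι → P, (∀ i ∈ D, StrictRel (r i (g i)) a b) → StrictRel (F g) a b

/-- If the members of `D` strictly prefer `a` to `b` and everybody else strictly prefers
`b` to `a`, then society strictly prefers `a` to `b`. -/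
def LocallyDecisiveOnPair (a b : V) : Prop :=
  ∀ g : ι → P, (∀ i ∈ D, StrictRel (r i (g i)) a b) →
    (∀ i ∉ D, StrictRel (r i (g i)) b a) → StrictRel (F g) a b

variable {r F D}

theorem DecisiveOnPair.locallyDecisiveOnPair {a b : V} (h : DecisiveOnPair r F D a b) :
    LocallyDecisiveOnPair r F D a b :=
  fun g hg _ => h g hg

theorem LocallyDecisiveOnPair.decisiveOnPair_left
    (htot : ∀ i p x y, r i p x y ∨ r i p y x)
    (htrans : ∀ i p x y z, r i p x y → r i p y z → r i p x z)
    (hF : ∀ g x y z, F g x y → F g y z → F g x z)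
    (hrich : ∀ i, RichOnTriples (r i))
    (hpar : ∀ g x y, (∀ i, StrictRel (r i (g i)) x y) → StrictRel (F g) x y)
    (hind : ∀ g g' x y, x ≠ y → (∀ i, SameOnPair (r i (g i)) (r i (g' i)) x y) →
      SameOnPair (F g) (F g') x y)
    {a b c : V} (hab : a ≠ b) (hac : a ≠ c) (hbc : b ≠ c)
    (h : LocallyDecisiveOnPair r F D a b) : DecisiveOnPair r F D a c := by
  intro g hg
  have hex : ∀ i, ∃ p, SameOnPair (r i p) (r i (g i)) a c ∧ StrictRel (r i p) b c ∧
      (i ∈ D → StrictRel (r i p) a b) ∧ (i ∉ D → StrictRel (r i p) b a) := by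
    intro i
    by_cases hiD : i ∈ D
    · obtain ⟨p, h1, h2⟩ := (hrich i a b c hab hac hbc).1
      have h3 := h1.transitive (htrans i p) h2
      exact ⟨p, ⟨iff_of_true h3.1 (hg i hiD).1, iff_of_false h3.2 (hg i hiD).2⟩, h2,
        fun _ => h1, fun k => absurd hiD k⟩
    · obtain ⟨p, h1, h2, h3⟩ := (hrich i).exists_top (htrans i) (htot i (g i)) hab hac hbc
      exact ⟨p, h3, h2, fun k => absurd k hiD, fun _ => h1⟩
  choose g' h1 h2 h3 h4 using hex
  exact (hind g' g a c hac h1).strictRel_iff.1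
    ((h g' h3 h4).transitive (hF g') (hpar g' b c h2))

theorem LocallyDecisiveOnPair.decisiveOnPair_right
    (htot : ∀ i p x y, r i p x y ∨ r i p y x)
    (htrans : ∀ i p x y z, r i p x y → r i p y z → r i p x z)
    (hF : ∀ g x y z, F g x y → F g y z → F g x z)
    (hrich : ∀ i, RichOnTriples (r i))
    (hpar : ∀ g x y, (∀ i, StrictRel (r i (g i)) x y) → StrictRel (F g) x y)
    (hind : ∀ g g' x y, x ≠ y → (∀ i, SameOnPair (r i (g i)) (r i (g' i)) x y) →
      SameOnPair (F g) (F g') x y)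
    {a b c : V} (hab : a ≠ b) (hac : a ≠ c) (hbc : b ≠ c)
    (h : LocallyDecisiveOnPair r F D a b) : DecisiveOnPair r F D c b := by
  intro g hg
  have hex : ∀ i, ∃ p, SameOnPair (r i p) (r i (g i)) c b ∧ StrictRel (r i p) c a ∧
      (i ∈ D → StrictRel (r i p) a b) ∧ (i ∉ D → StrictRel (r i p) b a) := by
    intro i
    by_cases hiD : i ∈ D
    · obtain ⟨p, h1, h2⟩ := (hrich i c a b hac.symm hbc.symm hab).1
      have h3 := h1.transitive (htrans i p) h2
      exact ⟨p, ⟨iff_of_true h3.1 (hg i hiD).1, iff_of_false h3.2 (hg i hiD).2⟩, h1,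
        fun _ => h2, fun k => absurd hiD k⟩
    · obtain ⟨p, h1, h2, h3⟩ := (hrich i).exists_bottom (htrans i) (htot i (g i)) hab hac hbc
      exact ⟨p, h3, h2, fun k => absurd k hiD, fun _ => h1⟩
  choose g' h1 h2 h3 h4 using hex
  exact (hind g' g c b hbc.symm h1).strictRel_iff.1
    ((hpar g' c a h2).transitive (hF g') (h g' h3 h4))

theorem LocallyDecisiveOnPair.decisiveOnPair_of_ne
    (hV : ∀ x y : V, ∃ z, z ≠ x ∧ z ≠ y)
    (htot : ∀ i p x y, r i p x y ∨ r i p y x)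
    (htrans : ∀ i p x y z, r i p x y → r i p y z → r i p x z)
    (hF : ∀ g x y z, F g x y → F g y z → F g x z)
    (hrich : ∀ i, RichOnTriples (r i))
    (hpar : ∀ g x y, (∀ i, StrictRel (r i (g i)) x y) → StrictRel (F g) x y)
    (hind : ∀ g g' x y, x ≠ y → (∀ i, SameOnPair (r i (g i)) (r i (g' i)) x y) →
      SameOnPair (F g) (F g') x y)
    {a b : V} (hab : a ≠ b) (h : LocallyDecisiveOnPair r F D a b)
    {x y : V} (hxy : x ≠ y) : DecisiveOnPair r F D x y := by
  have left : ∀ {u v z : V}, u ≠ v → u ≠ z → v ≠ z → LocallyDecisiveOnPair r F D u v →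
      DecisiveOnPair r F D u z := fun h1 h2 h3 hl =>
    hl.decisiveOnPair_left htot htrans hF hrich hpar hind h1 h2 h3
  have right : ∀ {u v z : V}, u ≠ v → u ≠ z → v ≠ z → LocallyDecisiveOnPair r F D u v →
      DecisiveOnPair r F D z v := fun h1 h2 h3 hl =>
    hl.decisiveOnPair_right htot htrans hF hrich hpar hind h1 h2 h3
  have from_a : ∀ v, a ≠ v → DecisiveOnPair r F D a v := by
    intro v hav
    by_cases hbv : b = v
    · subst hbv
      obtain ⟨c, hca, hcb⟩ := hV a b
      exact left hca.symm hab hcb (left hab hca.symm hcb.symm h).locallyDecisiveOnPair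
    · exact left hab hav hbv h
  have avoiding_a : ∀ u v, a ≠ u → a ≠ v → u ≠ v → DecisiveOnPair r F D u v :=
    fun u v hau hav huv => right hav hau huv.symm (from_a v hav).locallyDecisiveOnPair
  by_cases hax : a = x
  · subst hax
    exact from_a y hxy
  · by_cases hay : a = y
    · subst hay
      obtain ⟨z, hza, hzx⟩ := hV a x
      exact left hzx.symm hxy hza
        (avoiding_a x z hax hza.symm hzx.symm).locallyDecisiveOnPair
    · exact avoiding_a x y hax hay hxy

end SocialChoice

section Representation

variable {S ℰ W : Type}

/-- Operators satisfying (ESF1), (ESF3) and (ESF4) are represented by an assignment. -/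
theorem exists_assignment_represents {B : ℰ → Set W} (hB : ∀ E : ℰ, (B E).Nonempty)
    (hsurj : ∀ A : Set W, A.Nonempty → ∃ E : ℰ, B E = A)
    {nab : Profile S ℰ → ℰ → ℰ} (h1 : ESF1 B nab) (h3 : ESF3 B nab) (h4 : ESF4 B nab) :
    ∃ f : Profile S ℰ → W → W → Prop, IsAssignment f ∧ Represents B nab f := by
  have up : ∀ (Φ : Profile S ℰ) (E E₁ : ℰ) (a b : W), a ∈ B E → B E₁ = {a, b} →
      a ∈ B (nab Φ E₁) → b ∈ B (nab Φ E) → a ∈ B (nab Φ E) := by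
    intro Φ E E₁ a b ha hE₁ ha₁ hb
    have hsub : B E₁ = B E ∩ B E₁ := by
      rw [eq_comm, Set.inter_eq_right, hE₁]
      rintro x (rfl | rfl)
      · exact ha
      · exact h1 _ _ hb
    exact (h4 Φ E₁ E E₁ hsub ⟨b, hb, by simp [hE₁]⟩ ha₁).1
  have down : ∀ (Φ : Profile S ℰ) (E E₁ : ℰ) (a b : W), a ∈ B (nab Φ E) → b ∈ B E →
      B E₁ = {a, b} → a ∈ B (nab Φ E₁) := by
    intro Φ E E₁ a b ha hb hE₁
    have hsub : B E₁ = B E ∩ B E₁ := by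
      rw [eq_comm, Set.inter_eq_right, hE₁]
      rintro x (rfl | rfl)
      · exact h1 _ _ ha
      · exact hb
    exact h3 Φ E₁ E E₁ hsub ⟨ha, by simp [hE₁]⟩
  refine ⟨fun Φ a b => ∃ E, B E = {a, b} ∧ a ∈ B (nab Φ E), fun Φ => ⟨?_, ?_⟩, ?_⟩
  · intro a b
    obtain ⟨E, hE⟩ := hsurj {a, b} ⟨a, by simp⟩
    obtain ⟨x, hx⟩ := hB (nab Φ E)
    have hxE := h1 _ _ hx
    rw [hE] at hxE
    rcases hxE with rfl | rfl
    · exact Or.inl ⟨E, hE, hx⟩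
    · exact Or.inr ⟨E, by rw [hE, Set.pair_comm], hx⟩
  · rintro a b c ⟨E₁, hE₁, ha⟩ ⟨E₂, hE₂, hb⟩
    obtain ⟨E, hE⟩ := hsurj {a, b, c} ⟨a, by simp⟩
    obtain ⟨E₃, hE₃⟩ := hsurj {a, c} ⟨a, by simp⟩
    have haE : a ∈ B E := by simp [hE]
    have hbE : b ∈ B E := by simp [hE]
    have hcE : c ∈ B E := by simp [hE]
    have hba : b ∈ B (nab Φ E) → a ∈ B (nab Φ E) := up Φ E E₁ a b haE hE₁ ha
    have hcb : c ∈ B (nab Φ E) → b ∈ B (nab Φ E) := up Φ E E₂ b c hbE hE₂ hb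
    obtain ⟨x, hx⟩ := hB (nab Φ E)
    have hxE := h1 _ _ hx
    rw [hE] at hxE
    have haM : a ∈ B (nab Φ E) := by
      rcases hxE with rfl | rfl | rfl
      · exact hx
      · exact hba hx
      · exact hba (hcb hx)
    exact ⟨E₃, hE₃, down Φ E E₃ a c haM hcE hE₃⟩
  · intro Φ E
    ext a
    constructor
    · intro ha
      refine ⟨h1 _ _ ha, fun b hb => ?_⟩
      obtain ⟨E₁, hE₁⟩ := hsurj {a, b} ⟨a, by simp⟩
      exact ⟨E₁, hE₁, down Φ E E₁ a b ha hb hE₁⟩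
    · rintro ⟨haE, ha⟩
      obtain ⟨b, hb⟩ := hB (nab Φ E)
      obtain ⟨E₁, hE₁, ha₁⟩ := ha b (h1 _ _ hb)
      exact up Φ E E₁ a b haE hE₁ ha₁ hb

variable {B : ℰ → Set W} {nab : Profile S ℰ → ℰ → ℰ} {f : Profile S ℰ → W → W → Prop}

theorem Represents.eq_left_iff_strictRel (hf : IsAssignment f) (hrep : Represents B nab f)
    {Φ : Profile S ℰ} {E : ℰ} {a b : W} (hab : a ≠ b) (hE : B E = {a, b}) :
    B (nab Φ E) = {a} ↔ StrictRel (f Φ) a b := by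
  rw [hrep, hE, maxSet_pair_eq_left_iff (hf Φ).1 hab]

theorem Represents.inter_eq_empty_iff_strictRel (hf : IsAssignment f)
    (hrep : Represents B nab f) {Φ : Profile S ℰ} {E E' : ℰ} {a b : W}
    (hE : B E = {a, b}) (hE' : B E' = {b}) :
    B (nab Φ E) ∩ B E' = ∅ ↔ StrictRel (f Φ) a b := by
  rw [hE', Set.inter_singleton_eq_empty, hrep, hE, mem_maxSet_pair_right (hf Φ).1]
  exact ⟨fun h => ⟨((hf Φ).1 a b).resolve_right h, h⟩, fun h => h.2⟩

theorem Represents.mem_of_strictRel (hf : IsAssignment f)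
    (hrep : Represents B nab f) {Φ : Profile S ℰ} {E : ℰ} {a b : W}
    (hE : B E = {a, b}) (h : StrictRel (f Φ) a b) : a ∈ B (nab Φ E) := by
  rw [hrep, hE]
  exact (mem_maxSet_pair_left (hf Φ).1).2 h.1

theorem Represents.richOnTriples (hsurj : ∀ A : Set W, A.Nonempty → ∃ E : ℰ, B E = A)
    (hf : IsAssignment f) (hrep : Represents B nab f) (hsd : ESFSD B nab) (i : S) :
    RichOnTriples fun E => f (Profile.single i E) := by
  intro x y z hxy hxz hyz
  obtain ⟨E₁, hE₁⟩ := hsurj {x, y} ⟨x, by simp⟩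
  obtain ⟨E₂, hE₂⟩ := hsurj {y, z} ⟨y, by simp⟩
  obtain ⟨-, ⟨p, hp₁, hp₂⟩, ⟨q, hq₁, hq₂⟩, ⟨s, hs₁, hs₂⟩⟩ :=
    hsd i x y z hxy hxz hyz E₁ E₂ hE₁ hE₂
  refine ⟨⟨s, ?_, ?_⟩, ⟨q, ?_, ?_⟩, ⟨p, ?_⟩⟩
  · exact (hrep.eq_left_iff_strictRel hf hxy hE₁).1 hs₁
  · exact (hrep.eq_left_iff_strictRel hf hyz hE₂).1 hs₂
  · exact (hrep.eq_left_iff_strictRel hf hxy hE₁).1 hq₁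
  · rw [hrep, hE₂] at hq₂
    exact maxSet_pair_eq_self (hf _).1 hq₂
  · rw [hrep, hE₁] at hp₁
    exact and_assoc.1 ⟨maxSet_pair_eq_self (hf _).1 hp₁,
      (hrep.eq_left_iff_strictRel hf hyz hE₂).1 hp₂⟩

theorem Represents.propP (hsurj : ∀ A : Set W, A.Nonempty → ∃ E : ℰ, B E = A)
    (hf : IsAssignment f) (hrep : Represents B nab f) (hp : ESFP B nab) : PropP f := by
  intro Φ a b h
  obtain ⟨E, hE⟩ := hsurj {a, b} ⟨a, by simp⟩
  obtain ⟨E', hE'⟩ := hsurj {b} ⟨b, rfl⟩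
  refine (hrep.inter_eq_empty_iff_strictRel hf hE hE').1 (hp Φ E E' ⟨a, ?_⟩ fun i => ?_)
  · exact Set.mem_iInter.2 fun i => hrep.mem_of_strictRel hf hE (h i)
  · exact (hrep.inter_eq_empty_iff_strictRel hf hE hE').2 (h i)

theorem Represents.propInd (hsurj : ∀ A : Set W, A.Nonempty → ∃ E : ℰ, B E = A)
    (hf : IsAssignment f) (hrep : Represents B nab f) (hi : ESFI B nab) : PropInd f := by
  intro N hN g g' a b h
  obtain ⟨E, hE⟩ := hsurj {a, b} ⟨a, by simp⟩
  have key := hi N hN g g' E fun E' hE' j => by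
    rw [hrep, hrep]
    exact (h j).maxSet_eq (hf _).1 (hf _).1 (hE ▸ hE')
  rw [hrep, hrep, hE] at key
  constructor
  · rw [← mem_maxSet_pair_left (hf _).1, key, mem_maxSet_pair_left (hf _).1]
  · rw [← mem_maxSet_pair_right (hf _).1, key, mem_maxSet_pair_right (hf _).1]

end Representation

end BeliefMerging

open BeliefMerging in
/-- Generalized propagation theorem. -/
theorem generalized_propagation
    {S ℰ W : Type} [LinearOrder S] [Nonempty S] [Fintype W] [Nonempty W]
    (hcard : 4 ≤ Fintype.card W)
    (B : ℰ → Set W) (hB : ∀ E : ℰ, (B E).Nonempty)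
    (hsurj : ∀ A : Set W, A.Nonempty → ∃ E : ℰ, B E = A)
    (nab : Profile S ℰ → ℰ → ℰ) (hbf : BasicFusion B nab)
    (hsd : ESFSD B nab) (hp : ESFP B nab) (hi : ESFI B nab)
    (N : Finset S) (hN : N.Nonempty) (D : Finset S) (hD : D ⊆ N)
    (w w' : W) (hww' : w ≠ w')
    (Eww' Ew' : ℰ) (h₁ : B Eww' = {w, w'}) (h₂ : B Ew' = {w'})
    (hloc : LocallyDecisiveFor B nab N hN D hD Eww' Ew') :
    DecisiveCoalition B nab N hN D hD := by
  obtain ⟨hE1, -, hE3, hE4⟩ := hbf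
  obtain ⟨f, hf, hrep⟩ := exists_assignment_represents hB hsurj hE1 hE3 hE4
  let r : {x // x ∈ N} → ℰ → W → W → Prop := fun i E => f (Profile.single i.1 E)
  let F : ({x // x ∈ N} → ℰ) → W → W → Prop := fun g => f ⟨N, hN, g⟩
  have hW : ∀ x y : W, ∃ z, z ≠ x ∧ z ≠ y := by
    classical
    intro x y
    have hlt : ({x, y} : Finset W).card < Fintype.card W :=
      lt_of_le_of_lt Finset.card_le_two (by omega)
    obtain ⟨z, hz⟩ := Finset.exists_mem_notMem_of_card_lt_card
      (s := {x, y}) (t := Finset.univ) hlt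
    exact ⟨z, by simpa using hz⟩
  have hlocal : LocallyDecisiveOnPair r F {i | i.1 ∈ D} w w' := by
    intro g hgD hgN
    refine (hrep.inter_eq_empty_iff_strictRel hf h₁ h₂).1 (hloc g ?_ ?_ ⟨w, ?_⟩)
    · exact fun i => (hrep.inter_eq_empty_iff_strictRel hf h₁ h₂).2 (hgD ⟨i.1, hD i.2⟩ i.2)
    · intro j hj
      rw [h₂]
      exact (hrep.eq_left_iff_strictRel hf hww'.symm (by rw [h₁, Set.pair_comm])).2 (hgN j hj)
    · exact Set.mem_iInter.2 fun i =>
        hrep.mem_of_strictRel hf h₁ (hgD ⟨i.1, hD i.2⟩ i.2)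
  have hdec : ∀ x y : W, x ≠ y → DecisiveOnPair r F {i | i.1 ∈ D} x y := fun x y hxy =>
    hlocal.decisiveOnPair_of_ne hW (fun i p => (hf (Profile.single i.1 p)).1)
      (fun i p => (hf (Profile.single i.1 p)).2) (fun g => (hf ⟨N, hN, g⟩).2)
      (fun i => hrep.richOnTriples hsurj hf hsd i.1)
      (fun g => hrep.propP hsurj hf hp ⟨N, hN, g⟩)
      (fun g g' x y _ => hrep.propInd hsurj hf hi N hN g g' x y) hww' hxy
  intro E E' g hdisj hne
  obtain ⟨x, hx⟩ := hne
  rw [Set.mem_iInter] at hx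
  rcases D.eq_empty_or_nonempty with rfl | ⟨i₀, hi₀⟩
  · exact absurd (hdec w' w hww'.symm g (by simp)).1 (hdec w w' hww' g (by simp)).2
  · rw [Set.eq_empty_iff_forall_notMem]
    rintro y ⟨hy, hyE'⟩
    have hyE : y ∈ B E := hE1 _ _ hy
    have hxE : x ∈ B E := hE1 _ _ (hx ⟨i₀, hi₀⟩)
    have hstrict : ∀ i : {i // i ∈ N}, i.1 ∈ D → StrictRel (r i (g i)) x y := by
      intro i hiD
      have hxi := hx ⟨i.1, hiD⟩
      rw [hrep] at hxi
      refine ⟨hxi.2 y hyE, fun hyx => ?_⟩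
      have hyi : y ∈ B (nab (Profile.single i.1 (g i)) E) := by
        rw [hrep]
        exact ⟨hyE, fun z hz => (hf _).2 _ _ _ hyx (hxi.2 z hz)⟩
      exact Set.eq_empty_iff_forall_notMem.1 (hdisj ⟨i.1, hiD⟩) y ⟨hyi, hyE'⟩
    have hxy : x ≠ y := by
      rintro rfl
      have h := hstrict ⟨i₀, hD hi₀⟩ hi₀
      exact h.2 h.1
    rw [hrep] at hy
    exact (hdec x y hxy g hstrict).2 (hy.2 x hxE)
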